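/- Let M ⪯ N be models of a complete NIP first-order L-theory. Let φ(x,y) be an L-formula with parameters from M and let b be a tuple from N. Assume φ(x,b) does not divide over M, and let q(y) = tp(b/M) be the complete type of b over M. Then the family of formulas {φ(x,b′) : b′ a tuple from N realizing q} is consistent. -/

import Mathlib

open FirstOrder FirstOrder.Language

universe u v w

namespace DistalPaper

variable (L : FirstOrder.Language.{u, v})

def SameTypeOver {N : Type w} [L.Structure N] (A : Set N) {γ : Type*} (b b' : γ → N) : Prop :=
  ∀ (p : ℕ) (φ : L.Formula (γ ⊕ Fin p)) (m : Fin p → N), (∀ i, m i ∈ A) →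
    (φ.Realize (Sum.elim b m) ↔ φ.Realize (Sum.elim b' m))

def IsIndiscernibleOver {N : Type w} [L.Structure N] (A : Set N) {I : Type*} [LinearOrder I]
    {γ : Type*} (b : I → γ → N) : Prop :=
  ∀ (m : ℕ) (i j : Fin m → I), StrictMono i → StrictMono j →
    SameTypeOver L A (fun q : Fin m × γ => b (i q.1) q.2) (fun q : Fin m × γ => b (j q.1) q.2)

def IsConsistentFamily {N : Type w} [L.Structure N] {α γ ι : Type*}
    (φ : L.Formula (α ⊕ γ)) (b : ι → γ → N) : Prop :=
  ∀ s : Finset ι, ∃ a : α → N, ∀ i ∈ s, φ.Realize (Sum.elim a (b i))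

structure ElemExt (N : Type w) [L.Structure N] where
  Carrier : Type max u v w
  [str : L.Structure Carrier]
  emb : N ↪ₑ[L] Carrier

attribute [instance] ElemExt.str

def Divides {N : Type w} [L.Structure N] (A : Set N) {α γ : Type*}
    (φ : L.Formula (α ⊕ γ)) (b : γ → N) : Prop :=
  ∃ (E : ElemExt L N) (c : ℕ → γ → E.Carrier),
    IsIndiscernibleOver L (⇑E.emb '' A) c ∧
    SameTypeOver L (⇑E.emb '' A) (c 0) (⇑E.emb ∘ b) ∧
    ¬ IsConsistentFamily L φ c

/-- The formula `φ(x, b)` forks over `A`: in some elementary extension it implies a finite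
disjunction of formulas, each of which divides over (the image of) `A`. -/
def Forks {N : Type w} [L.Structure N] (A : Set N) {α γ : Type*}
    (φ : L.Formula (α ⊕ γ)) (b : γ → N) : Prop :=
  ∃ (E : ElemExt L N) (k m : ℕ) (ψ : Fin k → L.Formula (α ⊕ Fin m))
    (c : Fin k → Fin m → E.Carrier),
    (∀ i, Divides L (⇑E.emb '' A) (ψ i) (c i)) ∧
    ∀ a : α → E.Carrier, φ.Realize (Sum.elim a (⇑E.emb ∘ b)) →
      ∃ i, (ψ i).Realize (Sum.elim a (c i))

/-- The complete type of the tuple `bs` over the parameter set `P` does not fork over `A`: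
no formula with parameters from `P` satisfied by `bs` forks over `A`. -/
def TypeDoesNotForkOver {N : Type w} [L.Structure N] (A P : Set N) {β : Type*}
    (bs : β → N) : Prop :=
  ∀ (p : ℕ) (φ : L.Formula (β ⊕ Fin p)) (c : Fin p → N), (∀ i, c i ∈ P) →
    φ.Realize (Sum.elim bs c) → ¬ Forks L A φ c

/-- `tp(a / A ∪ bs)` is strictly non-forking over `A`: it extends to a complete type `p`
over a monster model (an elementary extension `E` of `N`, realized by `a'` in a further
elementary extension `F`) such that `p` does not fork over `A` and, for the realization
`a'` of `p`, `tp(bs / A a')` does not fork over `A`. -/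
def StrictlyNonForkingOver {N : Type w} [L.Structure N] (A : Set N) {α β : Type*}
    (a : α → N) (bs : β → N) : Prop :=
  ∃ (E : ElemExt L N) (F : ElemExt L E.Carrier) (a' : α → F.Carrier),
    SameTypeOver L ((⇑F.emb ∘ ⇑E.emb) '' (A ∪ Set.range bs)) a' (⇑F.emb ∘ ⇑E.emb ∘ a) ∧
    TypeDoesNotForkOver L ((⇑F.emb ∘ ⇑E.emb) '' A) (Set.range ⇑F.emb) a' ∧
    TypeDoesNotForkOver L ((⇑F.emb ∘ ⇑E.emb) '' A)
      (((⇑F.emb ∘ ⇑E.emb) '' A) ∪ Set.range a') (⇑F.emb ∘ ⇑E.emb ∘ bs)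

/-- `b` is a strict Morley sequence over `A` for the complete type (over `A`) of the
tuple `q`: an `A`-indiscernible sequence of realizations of `tp(q/A)` such that each
`tp(b (n+1) / A, b 0, ..., b n)` is strictly non-forking over `A`. -/
def IsStrictMorleySequence {N : Type w} [L.Structure N] (A : Set N) {γ : Type*}
    (q : γ → N) (b : ℕ → γ → N) : Prop :=
  IsIndiscernibleOver L A b ∧
  (∀ n, SameTypeOver L A (b n) q) ∧
  ∀ n : ℕ, StrictlyNonForkingOver L A (b (n + 1)) (fun p : Fin (n + 1) × γ => b ↑p.1 p.2)

/-- `N` (equivalently, its complete theory) is NIP: no formula `φ(x, y)` has the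
independence property in any model of `Th(N)`. -/
def IsNIP (N : Type w) [L.Structure N] : Prop :=
  ∀ (nx ny : ℕ) (φ : L.Formula (Fin nx ⊕ Fin ny)),
    ¬ ∃ (K : Theory.ModelType.{u, v, max u v w} (L.completeTheory N))
        (a : ℕ → Fin nx → K) (bS : Set ℕ → Fin ny → K),
        ∀ (i : ℕ) (S : Set ℕ), φ.Realize (Sum.elim (a i) (bS S)) ↔ i ∈ S

/-- `N` is distal: it is NIP and, in every elementary extension, for every indiscernible
sequence `(b i)_{i ∈ ℤ}` and parameter set `A`, if the sequence with `b 0` omitted is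
indiscernible over `A`, then the whole sequence is indiscernible over `A`. -/
def IsDistal (N : Type w) [L.Structure N] : Prop :=
  IsNIP L N ∧
  ∀ (E : ElemExt L N) (m : ℕ) (b : ℤ → Fin m → E.Carrier) (A : Set E.Carrier),
    IsIndiscernibleOver L (∅ : Set E.Carrier) b →
    IsIndiscernibleOver L A (fun i : {i : ℤ // i ≠ 0} => b ↑i) →
    IsIndiscernibleOver L A b

/-- `N` is `κ`-saturated: every finitely satisfiable family of formulas in finitely many
free variables with parameters from a set of size `< κ` is realized in `N`. -/
def IsSaturated (κ : Cardinal.{w}) (N : Type w) [L.Structure N] : Prop :=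
  ∀ (A : Set N), Cardinal.mk A < κ →
    ∀ (n : ℕ) (ι : Type max u v w) (p : ι → ℕ) (φ : ∀ i, L.Formula (Fin n ⊕ Fin (p i)))
      (c : ∀ i, Fin (p i) → N), (∀ i j, c i j ∈ A) →
      (∀ s : Finset ι, ∃ a : Fin n → N, ∀ i ∈ s, (φ i).Realize (Sum.elim a (c i))) →
      ∃ a : Fin n → N, ∀ i, (φ i).Realize (Sum.elim a (c i))

/-- The complete type of `a` over the parameter set `P` (with `A ⊆ P`) extends to a
complete type over all of `N` which is `A`-invariant; the extension is encoded by a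
realization `a'` in an elementary extension of `N`. -/
def ExtendsToInvariantType {N : Type w} [L.Structure N] (A P : Set N) {α : Type*}
    (a : α → N) : Prop :=
  ∃ (E : ElemExt L N) (a' : α → E.Carrier),
    SameTypeOver L (⇑E.emb '' P) a' (⇑E.emb ∘ a) ∧
    ∀ (p : ℕ) (φ : L.Formula (α ⊕ Fin p)) (c c' : Fin p → N),
      SameTypeOver L A c c' →
      (φ.Realize (Sum.elim a' (⇑E.emb ∘ c)) ↔ φ.Realize (Sum.elim a' (⇑E.emb ∘ c')))

/-- Two sequences have the same Ehrenfeucht–Mostowski type over `A`: increasing tuples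
of the same length from either sequence have the same type over `A`. -/
def SameEMTypeOver {N : Type w} [L.Structure N] (A : Set N) {I J : Type*}
    [LinearOrder I] [LinearOrder J] {γ : Type*} (b : I → γ → N) (d : J → γ → N) : Prop :=
  ∀ (m : ℕ) (i : Fin m → I) (j : Fin m → J), StrictMono i → StrictMono j →
    SameTypeOver L A (fun q : Fin m × γ => b (i q.1) q.2) (fun q : Fin m × γ => d (j q.1) q.2)

/-- Insert the tuple `d` at position `0` into a sequence indexed by the nonzero integers. -/
def insertAtZero {X γ : Type*} (d : γ → X) (ds : {i : ℤ // i ≠ 0} → γ → X) : ℤ → γ → X :=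
  fun i => if h : i = 0 then d else ds ⟨i, h⟩


/-- Iterated ultrafilter power on lists; the head is the outermost quantifier. -/
noncomputable def itr {A : Type*} (D : Ultrafilter A) : ℕ → Ultrafilter (List A)
  | 0 => pure []
  | n + 1 => D.bind fun a => (itr D n).map (List.cons a)

theorem itr_zero {A : Type*} (D : Ultrafilter A) (P : List A → Prop) :
    (∀ᶠ l in (itr D 0 : Filter (List A)), P l) ↔ P [] := by
  simp [itr]

theorem itr_succ {A : Type*} (D : Ultrafilter A) (n : ℕ) (P : List A → Prop) :
    (∀ᶠ l in (itr D (n + 1) : Filter (List A)), P l) ↔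
      ∀ᶠ a in (D : Filter A), ∀ᶠ l in (itr D n : Filter (List A)), P (a :: l) :=
  Iff.rfl

theorem ev_bind {A B : Type*} (D : Ultrafilter A) (f : A → Ultrafilter B) (P : B → Prop) :
    (∀ᶠ b in (D.bind f : Filter B), P b) ↔
      ∀ᶠ a in (D : Filter A), ∀ᶠ b in (f a : Filter B), P b :=
  Iff.rfl

theorem ev_map {A B : Type*} (D : Ultrafilter A) (f : A → B) (P : B → Prop) :
    (∀ᶠ b in (D.map f : Filter B), P b) ↔ ∀ᶠ a in (D : Filter A), P (f a) :=
  Iff.rfl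

theorem itr_length {A : Type*} (D : Ultrafilter A) (n : ℕ) :
    ∀ᶠ l in (itr D n : Filter (List A)), l.length = n := by
  induction n with
  | zero => simp [itr_zero]
  | succ n ih =>
    rw [itr_succ]
    exact Filter.Eventually.of_forall fun a => ih.mono fun l hl => by simp [hl]

theorem itr_forall {A : Type*} (D : Ultrafilter A) (P : A → Prop)
    (h : ∀ᶠ a in (D : Filter A), P a) (n : ℕ) :
    ∀ᶠ l in (itr D n : Filter (List A)), ∀ a ∈ l, P a := by
  induction n with
  | zero => simp [itr_zero]
  | succ n ih =>
    rw [itr_succ]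
    filter_upwards [h] with a ha
    filter_upwards [ih] with l hl
    simpa using ⟨ha, hl⟩

theorem itr_map {A B : Type*} (D : Ultrafilter A) (f : A → B) (n : ℕ) (P : List B → Prop) :
    (∀ᶠ l in (itr (D.map f) n : Filter (List B)), P l) ↔
      ∀ᶠ l in (itr D n : Filter (List A)), P (l.map f) := by
  induction n generalizing P with
  | zero => simp [itr_zero]
  | succ n ih =>
    rw [itr_succ, itr_succ, ev_map]
    simp [ih]

/-- The product of an ultrafilter with itself; first component outermost. -/
noncomputable def sqU {A : Type*} (D : Ultrafilter A) : Ultrafilter (A × A) :=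
  D.bind fun a => D.map fun b => (a, b)

theorem itr_sel {A : Type*} (D : Ultrafilter A) (n : ℕ) (P : List A → Prop)
    (h : ∀ᶠ l in (itr D n : Filter (List A)), P l) :
    ∀ᶠ lp in (itr (sqU D) n : Filter (List (A × A))),
      ∀ l, List.Forall₂ (fun a (p : A × A) => a = p.1 ∨ a = p.2) l lp → P l := by
  induction n generalizing P with
  | zero =>
    rw [itr_zero] at h ⊢
    intro l hl
    cases hl
    exact h
  | succ n ih =>
    rw [itr_succ] at h ⊢
    have h2 : ∀ᶠ a in (D : Filter A), ∀ᶠ lp in (itr (sqU D) n : Filter (List (A × A))),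
      ∀ l, List.Forall₂ (fun a (p : A × A) => a = p.1 ∨ a = p.2) l lp → P (a :: l) := by
      filter_upwards [h] with a ha
      exact ih _ ha
    rw [sqU, ev_bind]
    filter_upwards [h2] with a ha
    rw [ev_map]
    filter_upwards [h2] with b hb
    rw [← sqU]
    filter_upwards [ha, hb] with lp h1 h3 l hl
    cases hl with
    | cons hx hl =>
      rcases hx with rfl | rfl
      · exact h1 _ hl
      · exact h3 _ hl

/-- No list of length `t` is shattered by `R`. -/
def NoShatter {A Y : Type*} (R : A → Y → Prop) (t : ℕ) : Prop :=
  ∀ l : List A, l.length = t → ∃ bs : List Bool, bs.length = t ∧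
    ∀ y, ¬ List.Forall₂ (fun a (b : Bool) => R a y ↔ b = true) l bs

theorem exists_sel {A Y : Type*} (R : A → Y → Prop) (y : Y) (lp : List (A × A)) :
    (∀ p ∈ lp, ¬ (R p.1 y ↔ R p.2 y)) → ∀ bs : List Bool, bs.length = lp.length →
    ∃ l, List.Forall₂ (fun a (p : A × A) => a = p.1 ∨ a = p.2) l lp ∧
      List.Forall₂ (fun a (b : Bool) => R a y ↔ b = true) l bs := by
  induction lp with
  | nil =>
    intro _ bs hbs
    have : bs = [] := by simpa using hbs
    subst this
    exact ⟨[], .nil, .nil⟩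
  | cons p lp ih =>
    intro h bs hbs
    cases bs with
    | nil => simp at hbs
    | cons b bs =>
      obtain ⟨l, h1, h2⟩ := ih (fun p hp => h p (by simp [hp])) bs (by simpa using hbs)
      have hp := h p (by simp)
      by_cases hb : (R p.1 y ↔ b = true)
      · exact ⟨p.1 :: l, .cons (Or.inl rfl) h1, .cons hb h2⟩
      · exact ⟨p.2 :: l, .cons (Or.inr rfl) h1, .cons (by tauto) h2⟩

theorem alternation {A Y : Type*} (R : A → Y → Prop) (t : ℕ) (hR : NoShatter R t)
    (D : Ultrafilter A) :
    ∀ᶠ lp in (itr (sqU D) t : Filter (List (A × A))),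
      ¬ ∃ y, ∀ p ∈ lp, ¬ (R p.1 y ↔ R p.2 y) := by
  by_contra hcon
  rw [Ultrafilter.eventually_not, not_not] at hcon
  have key : ∀ bs : List Bool, bs.length = t → ∀ᶠ l in (itr D t : Filter (List A)),
      ∃ y, List.Forall₂ (fun a (b : Bool) => R a y ↔ b = true) l bs := by
    intro bs hbs
    by_contra hn
    rw [← Ultrafilter.eventually_not] at hn
    have h1 := itr_sel D t _ hn
    obtain ⟨lp, ⟨h1, y, h2⟩, h3⟩ := ((h1.and hcon).and (itr_length _ _)).exists
    obtain ⟨l, hl, hl'⟩ := exists_sel R y lp h2 bs (by omega)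
    exact h1 l hl ⟨y, hl'⟩
  have fin : {bs : List Bool | bs.length = t}.Finite := List.finite_length_eq Bool t
  have h4 : ∀ᶠ l in (itr D t : Filter (List A)), ∀ bs ∈ {bs : List Bool | bs.length = t},
      ∃ y, List.Forall₂ (fun a (b : Bool) => R a y ↔ b = true) l bs :=
    (Filter.eventually_all_finite fin).2 key
  obtain ⟨l, h5, h6⟩ := (h4.and (itr_length _ _)).exists
  obtain ⟨bs, hb, hb'⟩ := hR l h6
  obtain ⟨y, hy⟩ := h5 bs hb
  exact hb' y hy

/-- The abstract broom lemma. -/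
theorem broom {Z V ι : Type*} [DecidableEq ι] (π : Ultrafilter Z) (Y : ι → Z → Set V)
    (JN : ℕ → Set V → Prop) (𝒯 : Set V → Prop)
    (J0 : ∀ n S S', S ⊆ S' → JN n S' → JN n S)
    (J1 : JN 0 ∅)
    (J2 : ∀ n m S S', JN n S → JN m S' → JN (n + m) (S ∪ S'))
    (hT : ∀ (I : Finset ι) z T, 𝒯 T → 𝒯 {y | y ∈ T ∧ ∀ i ∈ I, y ∉ Y i z})
    (s : ι → Ultrafilter Z)
    (hs : ∀ (i : ι) (I : Finset ι) (N : ℕ) T, 𝒯 T →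
      ((∀ᶠ z in (s i : Filter Z), JN N {y | y ∈ T ∧ ∀ i ∈ I, y ∉ Y i z}) ↔
        ∀ᶠ z in (π : Filter Z), JN N {y | y ∈ T ∧ ∀ i ∈ I, y ∉ Y i z}))
    (t : ι → ℕ)
    (ht : ∀ i, ∀ᶠ l in (itr (s i) (t i) : Filter (List Z)), ¬ ∃ y, ∀ z ∈ l, y ∈ Y i z)
    (I : Finset ι) : ∀ N, ∃ N', ∀ T, 𝒯 T →
      (∀ᶠ z in (π : Filter Z), JN N {y | y ∈ T ∧ ∀ i ∈ I, y ∉ Y i z}) → JN N' T := by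
  induction I using Finset.induction_on with
  | empty =>
    intro N
    refine ⟨N, fun T _ h => ?_⟩
    obtain ⟨z, hz⟩ := h.exists
    exact J0 _ _ _ (fun y hy => by simpa using hy) hz
  | insert i0 I hi ih =>
    have claim : ∀ m N, ∃ N', ∀ T, 𝒯 T →
        (∀ᶠ l in (itr (s i0) m : Filter (List Z)),
          JN N {y | y ∈ T ∧ ∀ z ∈ l, ∀ i ∈ I, y ∉ Y i z}) → JN N' T := by
      intro m
      induction m with
      | zero =>
        intro N
        refine ⟨N, fun T _ h => ?_⟩
        rw [itr_zero] at h
        exact J0 _ _ _ (fun y hy => by simpa using hy) h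
      | succ m ihm =>
        intro N
        obtain ⟨N1, h1⟩ := ihm N
        obtain ⟨N2, h2⟩ := ih N1
        refine ⟨N2, fun T hTT h => h2 T hTT ?_⟩
        rw [← hs i0 _ _ _ hTT]
        rw [itr_succ] at h
        filter_upwards [h] with z hz
        apply h1 _ (hT _ _ _ hTT)
        filter_upwards [hz] with l hl
        refine J0 _ _ _ ?_ hl
        rintro y ⟨⟨hy, hy1⟩, hy2⟩
        refine ⟨hy, ?_⟩
        intro z' hz'
        rcases List.mem_cons.1 hz' with rfl | hz'
        · exact hy1
        · exact hy2 z' hz'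
    have JL : ∀ N (S : Z → Set V) (l : List Z), (∀ z ∈ l, JN N (S z)) →
        JN (l.length * N) {y | ∃ z ∈ l, y ∈ S z} := by
      intro N S l
      induction l with
      | nil => intro _; simpa using J1
      | cons z l ihl =>
        intro h
        have := J2 _ _ _ _ (ihl fun z hz => h z (by simp [hz])) (h z (by simp))
        have e : (z :: l).length * N = l.length * N + N := by simp; ring
        rw [e]
        refine J0 _ _ _ ?_ this
        rintro y ⟨z', hz', hy⟩
        rcases List.mem_cons.1 hz' with rfl | hz'
        · exact Or.inr hy
        · exact Or.inl ⟨z', hz', hy⟩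
    intro N
    obtain ⟨N', hN'⟩ := claim (t i0) (t i0 * N)
    refine ⟨N', fun T hTT h => hN' T hTT ?_⟩
    rw [← hs i0 _ _ _ hTT] at h
    filter_upwards [itr_forall _ _ h (t i0), itr_length (s i0) (t i0), ht i0] with l h1 h2 h3
    have := JL N _ l h1
    rw [h2] at this
    refine J0 _ _ _ ?_ this
    rintro y ⟨hy, hy1⟩
    push Not at h3
    obtain ⟨z, hz, hyz⟩ := h3 y
    refine ⟨z, hz, hy, ?_⟩
    intro i hi'
    rcases Finset.mem_insert.1 hi' with rfl | hi'
    · exact hyz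
    · exact hy1 z hz i hi'
section core

/-- Types of finite tuples of elements of `M`. -/
class Tup (M : Type w) (X : Type*) where
  Idx : Type
  fin : Finite Idx
  co : X ≃ (Idx → M)

instance tupSelf (M : Type w) : Tup M M where
  Idx := Unit
  fin := inferInstance
  co := (Equiv.funUnique Unit M).symm

instance tupPi (M : Type w) (ι : Type) [Finite ι] (X : Type*) [Tup M X] : Tup M (ι → X) where
  Idx := ι × Tup.Idx M X
  fin := by
    have := Tup.fin (M := M) (X := X)
    infer_instance
  co := (Equiv.piCongrRight fun _ => Tup.co (M := M)).trans (Equiv.curry ι (Tup.Idx M X) M).symm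

instance tupProd (M : Type w) (X Y : Type*) [Tup M X] [Tup M Y] : Tup M (X × Y) where
  Idx := Tup.Idx M X ⊕ Tup.Idx M Y
  fin := by
    have := Tup.fin (M := M) (X := X)
    have := Tup.fin (M := M) (X := Y)
    infer_instance
  co := (Equiv.prodCongr Tup.co Tup.co).trans (Equiv.sumArrowEquivProdArrow _ _ _).symm

instance (M : Type w) (X : Type*) [Tup M X] : Finite (Tup.Idx M X) := Tup.fin

/-- The `M`-definable predicates on a type of tuples. -/
def Df (L : FirstOrder.Language.{u, v}) (M : Type w) [L.Structure M] {X : Type*} [Tup M X]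
    (P : X → Prop) : Prop :=
  ∃ ψ : L.Formula (M ⊕ Tup.Idx M X), ∀ x, P x ↔ ψ.Realize (Sum.elim id (Tup.co x))

/-- Functions whose coordinates are constants or coordinates. -/
def Sf (M : Type w) {X Y : Type*} [Tup M X] [Tup M Y] (f : X → Y) : Prop :=
  ∀ j : Tup.Idx M Y, ∃ e : M ⊕ Tup.Idx M X, ∀ x,
    (Tup.co (f x) : Tup.Idx M Y → M) j = Sum.elim id (Tup.co x) e

variable {M : Type w}

theorem Sf.const {X Y : Type*} [Tup M X] [Tup M Y] (y : Y) : Sf M (fun _ : X => y) :=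
  fun j => ⟨Sum.inl (Tup.co y j), fun _ => rfl⟩

theorem Sf.id {X : Type*} [Tup M X] : Sf M (fun x : X => x) :=
  fun j => ⟨Sum.inr j, fun _ => rfl⟩

theorem Sf.comp {X Y Z : Type*} [Tup M X] [Tup M Y] [Tup M Z] {g : Y → Z} {f : X → Y}
    (hg : Sf M g) (hf : Sf M f) : Sf M (fun x => g (f x)) := by
  intro j
  obtain ⟨e, he⟩ := hg j
  rcases e with m | e
  · exact ⟨Sum.inl m, fun x => by rw [he]; rfl⟩
  · obtain ⟨e', he'⟩ := hf e
    exact ⟨e', fun x => by rw [he, ← he']; rfl⟩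

theorem Sf.fst {X Y Z : Type*} [Tup M X] [Tup M Y] [Tup M Z] {f : X → Y × Z}
    (hf : Sf M f) : Sf M (fun x => (f x).1) :=
  Sf.comp (fun j => ⟨Sum.inr (Sum.inl j), fun _ => rfl⟩) hf

theorem Sf.snd {X Y Z : Type*} [Tup M X] [Tup M Y] [Tup M Z] {f : X → Y × Z}
    (hf : Sf M f) : Sf M (fun x => (f x).2) :=
  Sf.comp (fun j => ⟨Sum.inr (Sum.inr j), fun _ => rfl⟩) hf

theorem Sf.prod {X Y Z : Type*} [Tup M X] [Tup M Y] [Tup M Z] {f : X → Y} {g : X → Z}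
    (hf : Sf M f) (hg : Sf M g) : Sf M (fun x => (f x, g x)) := by
  rintro (j | j)
  · exact hf j
  · exact hg j

theorem Sf.app {X Y : Type*} {ι : Type} [Finite ι] [Tup M X] [Tup M Y] {f : X → ι → Y}
    (hf : Sf M f) (i : ι) : Sf M (fun x => f x i) :=
  fun j => hf (i, j)

theorem Sf.pi {X Y : Type*} {ι : Type} [Finite ι] [Tup M X] [Tup M Y] {f : X → ι → Y}
    (hf : ∀ i, Sf M (fun x => f x i)) : Sf M f :=
  fun j => hf j.1 j.2

theorem Sf.snoc {X Y : Type*} {n : ℕ} [Tup M X] [Tup M Y] {f : X → Fin n → Y} {g : X → Y}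
    (hf : Sf M f) (hg : Sf M g) :
    Sf M (fun x => (Fin.snoc (f x) (g x) : Fin (n + 1) → Y)) := by
  refine Sf.pi fun i => ?_
  refine Fin.lastCases ?_ (fun i => ?_) i
  · simpa using hg
  · simpa using hf.app i

variable {L} [L.Structure M]

theorem Df.congr {X : Type*} [Tup M X] {P Q : X → Prop} (hP : Df L M P)
    (h : ∀ x, Q x ↔ P x) : Df L M Q := by
  have : Q = P := funext fun x => propext (h x)
  rwa [this]

theorem Df.comp {X Y : Type*} [Tup M X] [Tup M Y] {P : Y → Prop} {f : X → Y}
    (hP : Df L M P) (hf : Sf M f) : Df L M (fun x => P (f x)) := by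
  obtain ⟨ψ, hψ⟩ := hP
  choose e he using hf
  refine ⟨ψ.relabel (Sum.elim Sum.inl e), fun x => ?_⟩
  beta_reduce
  rw [hψ, Formula.realize_relabel]
  have : (Sum.elim id (Tup.co (f x)) : M ⊕ Tup.Idx M Y → M) =
      (Sum.elim id (Tup.co x)) ∘ (Sum.elim Sum.inl e) := by
    funext j
    rcases j with m | j
    · rfl
    · exact he j x
  rw [this]

theorem Df.const {X : Type*} [Tup M X] (p : Prop) : Df L M (fun _ : X => p) := by
  by_cases hp : p
  · exact ⟨⊤, fun x => by simp [hp]⟩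
  · exact ⟨⊥, fun x => by simp [hp]⟩

theorem Df.not {X : Type*} [Tup M X] {P : X → Prop} (hP : Df L M P) :
    Df L M (fun x => ¬ P x) := by
  obtain ⟨ψ, hψ⟩ := hP
  exact ⟨ψ.not, fun x => by beta_reduce; rw [hψ, Formula.realize_not]⟩

theorem Df.imp {X : Type*} [Tup M X] {P Q : X → Prop} (hP : Df L M P) (hQ : Df L M Q) :
    Df L M (fun x => P x → Q x) := by
  obtain ⟨ψ, hψ⟩ := hP
  obtain ⟨χ, hχ⟩ := hQ
  exact ⟨ψ.imp χ, fun x => by beta_reduce; rw [hψ, hχ, Formula.realize_imp]⟩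

theorem Df.and {X : Type*} [Tup M X] {P Q : X → Prop} (hP : Df L M P) (hQ : Df L M Q) :
    Df L M (fun x => P x ∧ Q x) :=
  ((hP.imp hQ.not).not).congr fun x => by tauto

theorem Df.iff {X : Type*} [Tup M X] {P Q : X → Prop} (hP : Df L M P) (hQ : Df L M Q) :
    Df L M (fun x => P x ↔ Q x) :=
  ((hP.imp hQ).and (hQ.imp hP)).congr fun x => by tauto

theorem Df.fall {X : Type*} [Tup M X] {ι : Type*} [Finite ι] {P : ι → X → Prop}
    (hP : ∀ i, Df L M (P i)) : Df L M (fun x => ∀ i, P i x) := by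
  choose ψ hψ using hP
  exact ⟨Formula.iInf ψ, fun x => by simp [hψ]⟩

theorem Df.fex {X : Type*} [Tup M X] {ι : Type*} [Finite ι] {P : ι → X → Prop}
    (hP : ∀ i, Df L M (P i)) : Df L M (fun x => ∃ i, P i x) :=
  ((Df.fall fun i => (hP i).not).not).congr fun x => by simp

theorem Df.ex {X Y : Type*} [Tup M X] [Tup M Y] {P : X → Y → Prop}
    (hP : Df L M (fun p : X × Y => P p.1 p.2)) : Df L M (fun x => ∃ y, P x y) := by
  obtain ⟨ψ, hψ⟩ := hP
  refine ⟨(ψ.relabel (Sum.elim (Sum.inl ∘ Sum.inl) (Sum.elim (Sum.inl ∘ Sum.inr) Sum.inr))).iExs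
    (Tup.Idx M Y), fun x => ?_⟩
  rw [Formula.realize_iExs]
  rw [← (Tup.co (M := M) (X := Y)).exists_congr_right]
  refine exists_congr fun y => ?_
  refine (hψ (x, y)).trans ?_
  rw [Formula.realize_relabel]
  have : ∀ a b : M ⊕ Tup.Idx M (X × Y) → M, a = b → (ψ.Realize a ↔ ψ.Realize b) := by
    rintro a _ rfl; rfl
  apply this
  funext j
  rcases j with m | j | j <;> rfl

theorem Df.all {X Y : Type*} [Tup M X] [Tup M Y] {P : X → Y → Prop}
    (hP : Df L M (fun p : X × Y => P p.1 p.2)) : Df L M (fun x => ∀ y, P x y) :=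
  ((Df.ex (P := fun x y => ¬ P x y) hP.not).not).congr fun x => by simp

theorem Df.eq {X Y : Type*} [Tup M X] [Tup M Y] {f g : X → Y} (hf : Sf M f) (hg : Sf M g) :
    Df L M (fun x => f x = g x) := by
  have h : Df L M (fun x => ∀ j, (Tup.co (f x) : Tup.Idx M Y → M) j = Tup.co (g x) j) := by
    refine Df.fall fun j => ?_
    obtain ⟨e, he⟩ := hf j
    obtain ⟨e', he'⟩ := hg j
    refine ⟨Term.equal (Term.var e) (Term.var e'), fun x => ?_⟩
    beta_reduce
    rw [Formula.realize_equal, Term.realize_var, Term.realize_var, he, he']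
  exact h.congr fun x => by rw [← funext_iff, Tup.co.injective.eq_iff]

/-- Only finitely many parameters occur in a formula. -/
theorem fin_params.{x} {M : Type w} [Nonempty M] {α : Type*} (ψ : L.Formula (M ⊕ α)) :
    ∃ (p : ℕ) (ψ' : L.Formula (α ⊕ Fin p)) (m : Fin p → M),
      ∀ (K : Type x) [L.Structure K] (g : M → K) (v : α → K),
        ψ'.Realize (Sum.elim v (g ∘ m)) ↔ ψ.Realize (Sum.elim g v) := by
  classical
  obtain ⟨p, ⟨e⟩⟩ := Finite.exists_equiv_fin ψ.freeVarFinset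
  let d : M := Classical.arbitrary M
  let f : ψ.freeVarFinset → α ⊕ Fin p := fun s =>
    Sum.elim (fun _ => Sum.inr (e s)) (fun a => Sum.inl a) s.1
  refine ⟨p, ψ.restrictFreeVar f, fun i => Sum.elim id (fun _ => d) (e.symm i).1, ?_⟩
  intro K _ g v
  refine BoundedFormula.realize_restrictFreeVar _ ?_
  rintro ⟨s, hs⟩
  rcases s with m | a
  · simp [f]
  · simp [f]

end core
section losSection

variable {L}

/-- An ultrapower, in the required universe, with the theorem of Los. -/
theorem ultra_exists.{x} {I : Type w} (U : Ultrafilter I) (N : Type w) [L.Structure N]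
    [Nonempty N] :
    ∃ (K : Type (max u v w)) (_ : L.Structure K) (q : (I → N) → K)
      (emb : N ↪ₑ[L] K), (∀ n, emb n = q (fun _ => n)) ∧
      ∀ (β : Type x) (ψ : L.Formula β) (y : β → I → N),
        ψ.Realize (fun i => q (y i)) ↔ ∀ᶠ a in (U : Filter I), ψ.Realize (fun i => y i a) := by
  let K0 := (U : Filter I).Product (fun _ => N)
  let _ : L.Structure (ULift.{max u v} K0) :=
    Equiv.inducedStructure (Equiv.ulift.{max u v} (α := K0)).symm
  let e : K0 ≃[L] ULift.{max u v} K0 :=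
    Equiv.inducedStructureEquiv (Equiv.ulift.{max u v} (α := K0)).symm
  let q0 : (I → N) → K0 := fun f => (f : (U : Filter I).Product (fun _ => N))
  have los : ∀ {β : Type _} (ψ : L.Formula β) (y : β → I → N),
        ψ.Realize (fun i => e (q0 (y i))) ↔
          ∀ᶠ a in (U : Filter I), ψ.Realize (fun i => y i a) := by
    intro β ψ y
    have h1 := StrongHomClass.realize_formula e ψ (v := fun i => q0 (y i))
    refine h1.trans ?_
    exact Ultraproduct.realize_formula_cast (M := fun _ : I => N) ψ y
  have los0 : ∀ {β : Type} (ψ : L.Formula β) (y : β → I → N),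
        ψ.Realize (fun i => e (q0 (y i))) ↔
          ∀ᶠ a in (U : Filter I), ψ.Realize (fun i => y i a) := by
    intro β ψ y
    have h1 := StrongHomClass.realize_formula e ψ (v := fun i => q0 (y i))
    refine h1.trans ?_
    exact Ultraproduct.realize_formula_cast (M := fun _ : I => N) ψ y
  refine ⟨ULift.{max u v} K0, inferInstance, fun f => e (q0 f),
    ⟨fun n => e (q0 fun _ => n), ?_⟩, fun _ => rfl, fun β ψ y => los ψ y⟩
  intro n ψ y
  have := los0 ψ (fun i _ => y i)
  rw [Filter.eventually_const] at this
  exact this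

theorem nip_internal {M : Type w} [L.Structure M] [Nonempty M] (hNIP : IsNIP L M)
    {X Y : Type*} [Tup M X] [Tup M Y] (R : X → Y → Prop)
    (hR : Df L M (fun p : X × Y => R p.1 p.2)) : ∃ t, NoShatter R t := by
  classical
  by_contra hcon
  have hcon : ∀ t, ∃ l : List X, l.length = t ∧ ∀ bs : List Bool, bs.length = t →
      ∃ y, List.Forall₂ (fun a (b : Bool) => R a y ↔ b = true) l bs := by
    intro t
    by_contra h
    apply hcon
    refine ⟨t, fun l hl => ?_⟩
    by_contra h2
    apply h
    refine ⟨l, hl, fun bs hbs => ?_⟩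
    by_contra h3
    apply h2
    exact ⟨bs, hbs, fun y hy => h3 ⟨y, hy⟩⟩
  choose l hl hy using hcon
  have hy : ∀ t (S : Set ℕ), ∃ y, ∀ i (hi : i < (l t).length), (R (l t)[i] y ↔ i ∈ S) := by
    intro t S
    obtain ⟨y, h⟩ := hy t ((List.range t).map fun i => decide (i ∈ S)) (by simp)
    refine ⟨y, fun i hi => ?_⟩
    have := (List.forall₂_iff_get.1 h).2 i hi (by simpa [hl] using hi)
    simpa using this
  choose y hy using hy
  obtain ⟨ψ, hψ⟩ := hR
  obtain ⟨p, ψ', m, hm⟩ := fin_params.{u, v, w, w, _} ψ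
  obtain ⟨nx, ⟨eX⟩⟩ := Finite.exists_equiv_fin (Tup.Idx M X)
  obtain ⟨ny, ⟨eY⟩⟩ := Finite.exists_equiv_fin (Tup.Idx M Y ⊕ Fin p)
  let U : Ultrafilter (ULift.{w} ℕ) := (Filter.hyperfilter ℕ).map ULift.up
  obtain ⟨K, iK, q, emb, hemb, los⟩ := ultra_exists.{u, v, w, 0} (L := L) U M
  let φ : L.Formula (Fin nx ⊕ Fin ny) := ψ'.relabel (Sum.elim (Sum.elim (fun i => Sum.inl (eX i))
    (fun j => Sum.inr (eY (Sum.inl j)))) (fun r => Sum.inr (eY (Sum.inr r))))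
  apply hNIP nx ny φ
  have x0 : Nonempty X := by
    have h1 := hl 1
    exact ⟨(l 1)[0]'(by omega)⟩
  let d : X := Classical.arbitrary X
  let A : ℕ → ULift.{w} ℕ → X := fun i t => (l t.down).getD i d
  have : K ⊨ L.completeTheory M := (emb.elementarilyEquivalent).theory_model
  have : Nonempty K := ⟨emb (Classical.arbitrary M)⟩
  refine ⟨⟨K⟩, fun i s => q (fun t => (Tup.co (A i t) : Tup.Idx M X → M) (eX.symm s)),
    fun S s => q (fun t => (Sum.elim (Tup.co (y t.down S)) m) (eY.symm s)), ?_⟩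
  intro i S
  have h := los _ φ (Sum.elim (fun s t => (Tup.co (A i t) : Tup.Idx M X → M) (eX.symm s))
    (fun s t => (Sum.elim (Tup.co (y t.down S)) m) (eY.symm s)))
  have e1 : (fun j => q ((Sum.elim (fun s t => (Tup.co (A i t) : Tup.Idx M X → M) (eX.symm s))
    (fun s t => (Sum.elim (Tup.co (y t.down S)) m) (eY.symm s))) j)) =
    Sum.elim (fun s => q (fun t => (Tup.co (A i t) : Tup.Idx M X → M) (eX.symm s)))
    (fun s => q (fun t => (Sum.elim (Tup.co (y t.down S)) m) (eY.symm s))) := by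
    funext j
    rcases j with j | j <;> rfl
  rw [e1] at h
  refine h.trans ?_
  have key : ∀ᶠ t in (U : Filter (ULift.{w} ℕ)), (φ.Realize fun j =>
      Sum.elim (fun s t => (Tup.co (A i t) : Tup.Idx M X → M) (eX.symm s))
      (fun s t => (Sum.elim (Tup.co (y t.down S)) m) (eY.symm s)) j t) ↔ i ∈ S := by
    change ∀ᶠ t in (Filter.hyperfilter ℕ : Filter ℕ), _
    filter_upwards [Nat.hyperfilter_le_atTop (Filter.eventually_gt_atTop i)] with t ht
    have hlt : i < (l t).length := by rw [hl]; exact ht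
    rw [← hy t S i hlt]
    have h2 := hψ ((l t)[i], y t S)
    refine Iff.trans ?_ h2.symm
    rw [← hm M id]
    rw [Formula.realize_relabel]
    have : ∀ a b : (Tup.Idx M (X × Y) ⊕ Fin p) → M, a = b → (ψ'.Realize a ↔ ψ'.Realize b) := by
      rintro a _ rfl; rfl
    apply this
    funext j
    have hA : A i (ULift.up t) = (l t)[i] := by
      simp [A, hlt]
    rcases j with (j | j) | j
    · simp [hA]; rfl
    · simp; rfl
    · simp
  constructor
  · intro h3
    obtain ⟨t, h4, h5⟩ := (h3.and key).exists
    exact h5.1 h4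
  · intro h3
    exact key.mono fun t ht => ht.2 h3

end losSection
section claimSection

/-- Finite intersection property for ultrafilters. -/
theorem fip {Z T : Type*} (S : T → Z → Prop) (h : ∀ s : Finset T, ∃ z, ∀ t ∈ s, S t z) :
    ∃ U : Ultrafilter Z, ∀ t, ∀ᶠ z in (U : Filter Z), S t z := by
  classical
  obtain ⟨U, hU⟩ := Ultrafilter.exists_ultrafilter_of_finite_inter_nonempty
    (Set.range fun t => {z | S t z}) (by
      intro F hF
      rcases isEmpty_or_nonempty T with hT | hT
      · have : (F : Set (Set Z)) = ∅ := by
          ext x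
          simp only [Set.mem_empty_iff_false, iff_false]
          intro hx
          obtain ⟨t, _⟩ := hF hx
          exact hT.elim t
        obtain ⟨z, _⟩ := h ∅
        rw [this]
        exact ⟨z, by simp⟩
      · choose! f hf using fun x (hx : x ∈ F) => hF hx
        obtain ⟨z, hz⟩ := h (F.image f)
        refine ⟨z, fun x hx => ?_⟩
        have h1 := hz (f x) (Finset.mem_image_of_mem f hx)
        rw [← hf x hx]
        exact h1)
  exact ⟨U, fun t => hU ⟨t, rfl⟩⟩

/-- The path through an array. -/
def pth {κ V : Type*} {n : ℕ} (z : Fin n → κ → V) (p : Fin n → κ) : Fin n → V :=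
  fun j => z j (p j)

theorem Sf.pth {M : Type w} {X V : Type*} {κ : Type} [Finite κ] [Tup M X] [Tup M V] {n : ℕ}
    {f : X → Fin n → κ → V} (hf : Sf M f) (p : Fin n → κ) : Sf M (fun x => pth (f x) p) :=
  Sf.pi fun j => (hf.app j).app (p j)

variable {L}

/-- The main claim. -/
def ClaimI (L : FirstOrder.Language.{u, v}) (M : Type w) [L.Structure M] {V : Type*} [Tup M V]
    {κ : Type} [Finite κ] (B : Ultrafilter (κ → V)) (n : ℕ) : Prop :=
  ∀ C : (κ → V) → Prop, Df L M C → (∀ᶠ d in (B : Filter (κ → V)), C d) →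
    ∀ (m : ℕ) (F : Fin m → (Fin n → V) → Prop), (∀ l, Df L M (F l)) →
      ∃ z : Fin n → κ → V, (∀ j, C (z j)) ∧ ∀ p p' l, F l (pth z p) ↔ F l (pth z p')

variable {M : Type w} [L.Structure M] {V : Type*} [Tup M V] {κ : Type} [Finite κ]

theorem claim_pi {B : Ultrafilter (κ → V)} {n : ℕ} (hI : ClaimI L M B n)
    (C : (κ → V) → Prop) (hC : Df L M C) (hCB : ∀ᶠ d in (B : Filter (κ → V)), C d) :
    ∃ π : Ultrafilter (Fin n → κ → V), (∀ᶠ z in (π : Filter (Fin n → κ → V)), ∀ j, C (z j)) ∧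
      ∀ F : (Fin n → V) → Prop, Df L M F → ∀ p p',
        ∀ᶠ z in (π : Filter (Fin n → κ → V)), F (pth z p) ↔ F (pth z p') := by
  obtain ⟨π, hπ⟩ := fip (Z := Fin n → κ → V) (T := {F : (Fin n → V) → Prop // Df L M F})
    (fun F z => (∀ j, C (z j)) ∧ ∀ p p', F.1 (pth z p) ↔ F.1 (pth z p')) (by
      intro s
      obtain ⟨z, h1, h2⟩ := hI C hC hCB s.card (fun i => (s.equivFin.symm i).1.1)
        (fun i => (s.equivFin.symm i).1.2)
      refine ⟨z, fun F hF => ⟨h1, fun p p' => ?_⟩⟩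
      have := h2 p p' (s.equivFin ⟨F, hF⟩)
      simpa using this)
  refine ⟨π, ?_, fun F hF p p' => ?_⟩
  · exact (hπ ⟨fun _ => True, Df.const _⟩).mono fun z hz => hz.1
  · exact (hπ ⟨F, hF⟩).mono fun z hz => hz.2 p p'

theorem exists_sp {n : ℕ} (π : Ultrafilter (Fin n → κ → V))
    (hπ : ∀ F : (Fin n → V) → Prop, Df L M F → ∀ p p',
        ∀ᶠ z in (π : Filter (Fin n → κ → V)), F (pth z p) ↔ F (pth z p'))
    (p0 p : Fin n → κ) :
    ∃ s : Ultrafilter (Fin n → κ → V),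
      (∀ A : (Fin n → κ → V) → Prop, Df L M A →
        ((∀ᶠ z in (s : Filter (Fin n → κ → V)), A z) ↔
          ∀ᶠ z in (π : Filter (Fin n → κ → V)), A z)) ∧
      s.map (fun z => pth z p) = π.map (fun z => pth z p0) := by
  obtain ⟨s, hs⟩ := fip (Z := Fin n → κ → V)
    (T := {A : (Fin n → κ → V) → Prop // Df L M A ∧ ∀ᶠ z in (π : Filter (Fin n → κ → V)), A z} ×
      {E : (Fin n → V) → Prop // ∀ᶠ z in (π : Filter (Fin n → κ → V)), E (pth z p0)})
    (fun t z => t.1.1 z ∧ t.2.1 (pth z p)) (by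
      intro s
      have hA : Df L M (fun z => ∀ t : s, t.1.1.1 z) := Df.fall fun t => t.1.1.2.1
      have hA' : ∀ᶠ z in (π : Filter (Fin n → κ → V)), ∀ t : s, t.1.1.1 z :=
        Filter.eventually_all.2 fun t => t.1.1.2.2
      have hE' : ∀ᶠ z in (π : Filter (Fin n → κ → V)), ∀ t : s, t.1.2.1 (pth z p0) :=
        Filter.eventually_all.2 fun t => t.1.2.2
      let G : (Fin n → V) → Prop := fun w => ∃ z : Fin n → κ → V, (∀ t : s, t.1.1.1 z) ∧
        pth z p = w
      have hG : Df L M G := by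
        refine Df.ex (P := fun w z => (∀ t : s, t.1.1.1 z) ∧ pth z p = w) ?_
        refine (hA.comp Sf.id.snd).and (Df.eq (Sf.id.snd.pth p) Sf.id.fst)
      obtain ⟨z, ⟨h1, h2⟩, h3⟩ := ((hA'.and hE').and (hπ G hG p p0)).exists
      obtain ⟨z', h4, h5⟩ := h3.1 ⟨z, h1, rfl⟩
      refine ⟨z', fun t ht => ⟨h4 ⟨t, ht⟩, ?_⟩⟩
      rw [h5]
      exact h2 ⟨t, ht⟩)
  have h1 : ∀ A : (Fin n → κ → V) → Prop, Df L M A →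
      (∀ᶠ z in (π : Filter (Fin n → κ → V)), A z) →
        ∀ᶠ z in (s : Filter (Fin n → κ → V)), A z := by
    intro A hA h
    exact (hs (⟨A, hA, h⟩, ⟨fun _ => True, by simp⟩)).mono fun z hz => hz.1
  refine ⟨s, fun A hA => ⟨fun h => ?_, h1 A hA⟩, ?_⟩
  · by_contra h2
    rw [← Ultrafilter.eventually_not] at h2
    have h3 := h1 _ hA.not h2
    obtain ⟨z, h4, h5⟩ := (h.and h3).exists
    exact h5 h4
  · rw [← Ultrafilter.coe_le_coe]
    intro E hE
    exact (hs (⟨fun _ => True, Df.const _, by simp⟩, ⟨fun w => w ∈ E, hE⟩)).mono fun z hz => hz.2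

theorem claim_zero (B : Ultrafilter (κ → V)) : ClaimI L M B 0 := by
  intro C _ _ m F _
  refine ⟨Fin.elim0, fun j => j.elim0, fun p p' l => ?_⟩
  rw [Subsingleton.elim (pth Fin.elim0 p : Fin 0 → V) (pth Fin.elim0 p')]

theorem pth_snoc {κ V : Type*} {n : ℕ} (z : Fin n → κ → V) (d : κ → V) (p : Fin (n + 1) → κ) :
    pth (Fin.snoc z d : Fin (n + 1) → κ → V) p =
      Fin.snoc (pth z (fun j => p j.castSucc)) (d (p (Fin.last n))) := by
  funext j
  refine Fin.lastCases ?_ (fun i => ?_) j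
  · simp [pth]
  · simp [pth]

theorem claim_succ [Nonempty M] (hNIP : IsNIP L M) (i0 : κ) (B : Ultrafilter (κ → V))
    (hB : ∀ A : V → Prop, Df L M A → ∀ i j, ∀ᶠ d in (B : Filter (κ → V)), A (d i) ↔ A (d j))
    (n : ℕ) (hI : ClaimI L M B n) : ClaimI L M B (n + 1) := by
  classical
  intro C hC hCB m F hF
  have := Fintype.ofFinite κ
  obtain ⟨π, hπC, hπ⟩ := claim_pi hI C hC hCB
  let Z := Fin n → κ → V
  let R : Fin m → (Fin n → V) → V → Prop := fun l c y => F l (Fin.snoc c y)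
  have hR : ∀ l, Df L M (fun q : (Fin n → V) × V => R l q.1 q.2) := fun l =>
    (hF l).comp (Sf.id.fst.snoc Sf.id.snd)
  have hR' : ∀ {X : Type _} [Tup M X] (l) (f : X → Fin n → V) (g : X → V), Sf M f → Sf M g →
    Df L M (fun x => R l (f x) (g x)) := fun l f g hf hg => (hR l).comp (hf.prod hg)
  choose t ht using fun l => nip_internal hNIP (R l) (hR l)
  let p0 : Fin n → κ := fun _ => i0
  let D := π.map (fun z => pth z p0)
  choose s hs hsD using exists_sp π hπ p0
  let Y : (Fin n → κ) × Fin m → Z × (Fin n → V) → Set V := fun i zc =>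
    {y | ¬ (R i.2 zc.2 y ↔ R i.2 (pth zc.1 i.1) y)}
  let JN : ℕ → Set V → Prop := fun N S => ∃ e : Fin N → Z, (∀ a j, C (e a j)) ∧
    ∀ y, y ∈ S → ∃ a, ∀ p p' l, R l (pth (e a) p) y ↔ R l (pth (e a) p') y
  obtain ⟨N', hN'⟩ := broom (D.bind fun c => π.map fun z => (z, c)) Y JN
    (fun T => Df L M (fun y => y ∈ T))
    (by
      rintro N S S' hSS ⟨e, h1, h2⟩
      exact ⟨e, h1, fun y hy => h2 y (hSS hy)⟩)
    ⟨Fin.elim0, fun a => a.elim0, fun y hy => hy.elim⟩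
    (by
      rintro N N' S S' ⟨e, h1, h2⟩ ⟨e', h1', h2'⟩
      refine ⟨Fin.append e e', fun a => ?_, ?_⟩
      · refine Fin.addCases (fun a => ?_) (fun a => ?_) a
        · simpa using h1 a
        · simpa using h1' a
      · rintro y (hy | hy)
        · obtain ⟨a, ha⟩ := h2 y hy
          exact ⟨Fin.castAdd _ a, by simpa using ha⟩
        · obtain ⟨a, ha⟩ := h2' y hy
          exact ⟨Fin.natAdd _ a, by simpa using ha⟩)
    (by
      intro I z T hT
      refine hT.and (Df.fall fun i => (Df.const (i ∈ I)).imp (Df.not (Df.not ?_)))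
      exact (hR' _ _ _ (Sf.const _) Sf.id).iff (hR' _ _ _ (Sf.const _) Sf.id))
    (fun i => D.bind fun c => (s i.1).map fun z => (z, c))
    (by
      intro i I N T hT
      rw [ev_bind, ev_bind]
      refine Filter.eventually_congr (Filter.Eventually.of_forall fun c => ?_)
      rw [ev_map, ev_map]
      apply hs
      refine Df.ex (Df.and ?_ ?_)
      · exact Df.fall fun a => Df.fall fun j => hC.comp ((Sf.id.snd.app a).app j)
      · refine Df.all (Df.imp (Df.and (hT.comp Sf.id.snd) ?_) ?_)
        · refine Df.fall fun i => (Df.const (i ∈ I)).imp (Df.not (Df.not ?_))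
          exact (hR' _ _ _ (Sf.const _) Sf.id.snd).iff
            (hR' _ _ _ (Sf.id.fst.fst.pth _) Sf.id.snd)
        · refine Df.fex fun a => Df.fall fun p => Df.fall fun p' => Df.fall fun l => ?_
          exact (hR' _ _ _ ((Sf.id.fst.snd.app a).pth _) Sf.id.snd).iff
            (hR' _ _ _ ((Sf.id.fst.snd.app a).pth _) Sf.id.snd))
    (fun i => t i.2)
    (by
      intro i
      have h1 := alternation (R i.2) (t i.2) (ht i.2) D
      have e1 : (D.bind fun c => (s i.1).map fun z => (z, c)).map
          (fun zc : Z × (Fin n → V) => (zc.2, pth zc.1 i.1)) = sqU D := by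
        apply Ultrafilter.coe_injective
        ext E
        change (∀ᶠ c in (D : Filter _), ∀ᶠ z in (s i.1 : Filter _), (c, pth z i.1) ∈ E) ↔
          (∀ᶠ c in (D : Filter _), ∀ᶠ z in (D : Filter _), (c, z) ∈ E)
        refine Filter.eventually_congr (Filter.Eventually.of_forall fun c => ?_)
        have h2 := hsD i.1
        change _ = D at h2
        rw [← h2, ev_map]
      rw [← e1, itr_map] at h1
      filter_upwards [h1] with l hl
      rintro ⟨y, hy⟩
      apply hl
      refine ⟨y, ?_⟩
      intro p hp
      obtain ⟨zc, hzc, rfl⟩ := List.mem_map.1 hp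
      exact hy zc hzc)
    Finset.univ 1
  have hJ : JN N' Set.univ := by
    apply hN' _ (Df.const _)
    rw [ev_bind]
    refine Filter.Eventually.of_forall fun c => ?_
    rw [ev_map]
    filter_upwards [hπC] with z hz
    refine ⟨fun _ => z, fun _ => hz, ?_⟩
    rintro y ⟨_, hy⟩
    refine ⟨0, fun p p' l => ?_⟩
    have h1 := hy (p, l) (Finset.mem_univ _)
    have h2 := hy (p', l) (Finset.mem_univ _)
    exact (not_not.1 h1).symm.trans (not_not.1 h2)
  obtain ⟨e, he, hy⟩ := hJ
  have hd : ∀ᶠ d in (B : Filter (κ → V)), ∀ (a : Fin N') (p : Fin n → κ) (l : Fin m) (i : κ),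
      (R l (pth (e a) p) (d i) ↔ R l (pth (e a) p) (d i0)) := by
    refine Filter.eventually_all.2 fun a => Filter.eventually_all.2 fun p =>
      Filter.eventually_all.2 fun l => Filter.eventually_all.2 fun i => ?_
    exact hB (fun y => R l (pth (e a) p) y) (hR' _ _ _ (Sf.const _) Sf.id) i i0
  obtain ⟨d, hCd, hd⟩ := (hCB.and hd).exists
  obtain ⟨a, ha⟩ := hy (d i0) trivial
  refine ⟨Fin.snoc (e a) d, fun j => ?_, fun p p' l => ?_⟩
  · refine Fin.lastCases ?_ (fun i => ?_) j
    · simpa using hCd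
    · simpa using he a i
  · rw [pth_snoc, pth_snoc]
    exact (hd a _ l _).trans ((ha _ _ l).trans (hd a _ l _).symm)

theorem claim_all [Nonempty M] (hNIP : IsNIP L M) (i0 : κ) (B : Ultrafilter (κ → V))
    (hB : ∀ A : V → Prop, Df L M A → ∀ i j, ∀ᶠ d in (B : Filter (κ → V)), A (d i) ↔ A (d j))
    (n : ℕ) : ClaimI L M B n := by
  induction n with
  | zero => exact claim_zero B
  | succ n ih => exact claim_succ hNIP i0 B hB n ih

end claimSection
section ramseySection

theorem itr_sublist {A : Type*} (H : Ultrafilter A) (K : ℕ) : ∀ (m : ℕ) (Q : List A → Prop),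
    (∀ᶠ l in (itr H m : Filter (List A)), Q l) →
    ∀ᶠ l in (itr H K : Filter (List A)), ∀ l', List.Sublist l' l → l'.length = m → Q l' := by
  induction K with
  | zero =>
    intro m Q h
    rw [itr_zero]
    intro l' hl' hm
    have : l' = [] := by simpa using hl'
    subst this
    have : m = 0 := by simpa using hm.symm
    subst this
    rwa [itr_zero] at h
  | succ K ih =>
    intro m Q h
    rw [itr_succ]
    have h1 := ih m Q h
    cases m with
    | zero =>
      refine Filter.Eventually.of_forall fun a => ?_
      refine Filter.Eventually.of_forall fun l => ?_
      intro l' _ hm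
      have : l' = [] := by simpa using hm
      subst this
      rwa [itr_zero] at h
    | succ m =>
      rw [itr_succ] at h
      filter_upwards [h] with a ha
      filter_upwards [h1, ih m _ ha] with l h2 h3
      intro l' hl' hm
      cases hl' with
      | cons _ hs => exact h2 _ hs hm
      | cons_cons _ hs => exact h3 _ hs (by simpa using hm)

theorem exists_rho : ∃ ρ : Ultrafilter (ℕ → ℕ),
    (∀ i j, i < j → ∀ᶠ κ in (ρ : Filter (ℕ → ℕ)), κ i < κ j) ∧
    ∀ (m : ℕ) (P : (Fin m → ℕ) → Prop) (i j : Fin m → ℕ), StrictMono i → StrictMono j →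
      ∀ᶠ κ in (ρ : Filter (ℕ → ℕ)), P (fun a => κ (i a)) ↔ P (fun a => κ (j a)) := by
  let H : Ultrafilter ℕ := Filter.hyperfilter ℕ
  let c : ∀ m : ℕ, ((Fin m → ℕ) → Prop) → Prop := fun m P =>
    ∀ᶠ l in (itr H m : Filter (List ℕ)), P (fun a : Fin m => l.getD a 0)
  obtain ⟨ρ, hρ⟩ := fip (Z := ℕ → ℕ)
    (T := Σ m : ℕ, ((Fin m → ℕ) → Prop) × {i : Fin m → ℕ // StrictMono i})
    (fun t κ => t.2.1 (fun a => κ (t.2.2.1 a)) ↔ c t.1 t.2.1) (by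
      intro s
      obtain ⟨K, hK⟩ : ∃ K, ∀ t ∈ s, ∀ a, t.2.2.1 a < K := by
        refine ⟨s.sup (fun t => Finset.univ.sup t.2.2.1) + 1, fun t ht a => ?_⟩
        have h1 := Finset.le_sup (f := fun t : Σ m : ℕ, ((Fin m → ℕ) → Prop) ×
          {i : Fin m → ℕ // StrictMono i} => Finset.univ.sup t.2.2.1) ht
        have h2 := Finset.le_sup (f := t.2.2.1) (Finset.mem_univ a)
        beta_reduce at h1
        omega
      have h1 : ∀ᶠ l in (itr H K : Filter (List ℕ)), ∀ t ∈ s, ∀ l', List.Sublist l' l →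
          l'.length = t.1 → (t.2.1 (fun a : Fin t.1 => l'.getD a 0) ↔ c t.1 t.2.1) := by
        refine (Filter.eventually_all_finset s).2 fun t _ => ?_
        apply itr_sublist H K t.1 (fun l => t.2.1 (fun a : Fin t.1 => l.getD a 0) ↔ c t.1 t.2.1)
        by_cases hc : c t.1 t.2.1
        · have hc' := hc
          filter_upwards [hc'] with l hl
          exact ⟨fun _ => hc, fun _ => hl⟩
        · have hc' := hc
          change ¬ ∀ᶠ l in (itr H t.1 : Filter (List ℕ)), _ at hc'
          rw [← Ultrafilter.eventually_not] at hc'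
          filter_upwards [hc'] with l hl
          exact ⟨fun h => absurd h hl, fun h => absurd h hc⟩
      obtain ⟨l, h1, h2⟩ := (h1.and (itr_length H K)).exists
      refine ⟨fun j => l.getD j 0, fun t ht => ?_⟩
      have h3 := h1 t ht (List.ofFn fun a => l.getD (t.2.2.1 a) 0) (by
        rw [List.sublist_iff_exists_fin_orderEmbedding_get_eq]
        have hlen : (List.ofFn fun a => l.getD (t.2.2.1 a) 0).length = t.1 := by simp
        refine ⟨OrderEmbedding.ofStrictMono
          (fun x => ⟨t.2.2.1 (Fin.cast hlen x), by rw [h2]; exact hK t ht _⟩) ?_, ?_⟩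
        · intro x y hxy
          exact t.2.2.2 (by simpa using hxy)
        · intro x
          have h4 : t.2.2.1 (Fin.cast hlen x) < l.length := by rw [h2]; exact hK t ht _
          simp only [List.get_eq_getElem, List.getElem_ofFn]
          exact List.getD_eq_getElem _ _ h4) (by simp)
      simpa using h3)
  refine ⟨ρ, fun i j hij => ?_, fun m P i j hi hj => ?_⟩
  · have h1 := hρ ⟨2, fun v => v 0 < v 1, ⟨![i, j], by
      intro a b hab
      fin_cases a <;> fin_cases b <;> simp_all⟩⟩
    have h2 : c 2 (fun v => v 0 < v 1) := by
      change ∀ᶠ l in (itr H 2 : Filter (List ℕ)), _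
      rw [itr_succ]
      refine Filter.Eventually.of_forall fun a => ?_
      rw [itr_succ]
      filter_upwards [Nat.hyperfilter_le_atTop (Filter.eventually_gt_atTop a)] with b hb
      rw [itr_zero]
      simpa using hb
    filter_upwards [h1] with κ hκ
    have := hκ.2 h2
    simpa using this
  · filter_upwards [hρ ⟨m, P, ⟨i, hi⟩⟩, hρ ⟨m, P, ⟨j, hj⟩⟩] with κ h1 h2
    exact h1.trans h2.symm

end ramseySection

section sigmaSection

variable {L} {M : Type w} [L.Structure M] {V : Type*} [Tup M V] {κ : Type} [Finite κ]

theorem exists_sigma (i0 : κ) (B : Ultrafilter (κ → V)) (hI : ∀ n, ClaimI L M B n) :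
    ∃ σ : Ultrafilter (ℕ → κ → V),
      (∀ C : (κ → V) → Prop, Df L M C → (∀ᶠ d in (B : Filter (κ → V)), C d) →
        ∀ j, ∀ᶠ arr in (σ : Filter (ℕ → κ → V)), C (arr j)) ∧
      ∀ (n : ℕ) (F : (Fin n → V) → Prop), Df L M F → ∀ p p',
        ∀ᶠ arr in (σ : Filter (ℕ → κ → V)),
          F (pth (fun j : Fin n => arr j) p) ↔ F (pth (fun j : Fin n => arr j) p') := by
  classical
  obtain ⟨d0⟩ : Nonempty (κ → V) := (B : Filter (κ → V)).nonempty_of_neBot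
  obtain ⟨σ, hσ⟩ := fip (Z := ℕ → κ → V)
    (T := {C : (κ → V) → Prop // Df L M C ∧ ∀ᶠ d in (B : Filter (κ → V)), C d} ×
      (Σ n : ℕ, {F : (Fin n → V) → Prop // Df L M F}))
    (fun t arr => (∀ j < t.2.1, t.1.1 (arr j)) ∧ ∀ p p',
      t.2.2.1 (pth (fun j : Fin t.2.1 => arr j) p) ↔
        t.2.2.1 (pth (fun j : Fin t.2.1 => arr j) p')) (by
      intro s
      obtain ⟨K, hK⟩ : ∃ K, ∀ t ∈ s, t.2.1 ≤ K :=
        ⟨s.sup (fun t => t.2.1), fun t ht => Finset.le_sup (f := fun t : {C : (κ → V) → Prop //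
          Df L M C ∧ ∀ᶠ d in (B : Filter (κ → V)), C d} ×
          (Σ n : ℕ, {F : (Fin n → V) → Prop // Df L M F}) => t.2.1) ht⟩
      obtain ⟨z, h1, h2⟩ := hI K (fun d => ∀ t : s, t.1.1.1 d)
        (Df.fall fun t => t.1.1.2.1) (Filter.eventually_all.2 fun t => t.1.1.2.2) s.card
        (fun i c => (s.equivFin.symm i).1.2.2.1
          (fun j => c (Fin.castLE (hK _ (s.equivFin.symm i).2) j)))
        (fun i => (s.equivFin.symm i).1.2.2.2.comp (Sf.pi fun j => Sf.id.app _))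
      refine ⟨fun j => if h : j < K then z ⟨j, h⟩ else d0, fun t ht => ⟨fun j hj => ?_, ?_⟩⟩
      · have : j < K := lt_of_lt_of_le hj (hK t ht)
        simpa [this] using h1 ⟨j, this⟩ ⟨t, ht⟩
      · have h3 := hK t ht
        have key : ∀ p : Fin t.2.1 → κ,
            pth (fun j : Fin t.2.1 => if h : (j : ℕ) < K then z ⟨j, h⟩ else d0) p =
            fun j => pth z (fun q : Fin K => if h : (q : ℕ) < t.2.1 then p ⟨q, h⟩ else i0)
              (Fin.castLE h3 j) := by
          intro p
          funext j
          have : (j : ℕ) < K := lt_of_lt_of_le j.2 h3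
          simp only [pth, this, dif_pos, Fin.val_castLE, j.2]
          rfl
        intro p p'
        have h4 := h2 (fun q : Fin K => if h : (q : ℕ) < t.2.1 then p ⟨q, h⟩ else i0)
          (fun q : Fin K => if h : (q : ℕ) < t.2.1 then p' ⟨q, h⟩ else i0)
          (s.equivFin ⟨t, ht⟩)
        rw [key, key]
        have e5 : s.equivFin.symm (s.equivFin ⟨t, ht⟩) = ⟨t, ht⟩ := by simp
        have gen : ∀ x : s, x = ⟨t, ht⟩ →
          ((x.1.2.2.1 (fun j => pth z (fun q : Fin K => if h : (q : ℕ) < t.2.1 then p ⟨q, h⟩ else i0)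
            (Fin.castLE (hK _ x.2) j)) ↔
          x.1.2.2.1 (fun j => pth z (fun q : Fin K => if h : (q : ℕ) < t.2.1 then p' ⟨q, h⟩ else i0)
            (Fin.castLE (hK _ x.2) j)))) →
          ((t.2.2.1 (fun j => pth z (fun q : Fin K => if h : (q : ℕ) < t.2.1 then p ⟨q, h⟩ else i0)
            (Fin.castLE h3 j)) ↔
          t.2.2.1 (fun j => pth z (fun q : Fin K => if h : (q : ℕ) < t.2.1 then p' ⟨q, h⟩ else i0)
            (Fin.castLE h3 j)))) := by
          rintro _ rfl h
          exact h
        exact gen _ e5 h4)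
  refine ⟨σ, fun C hC hCB j => ?_, fun n F hF p p' => ?_⟩
  · exact (hσ (⟨C, hC, hCB⟩, ⟨j + 1, fun _ => True, Df.const _⟩)).mono fun arr h =>
      h.1 j (Nat.lt_succ_self j)
  · exact (hσ (⟨fun _ => True, Df.const _, by simp⟩, ⟨n, F, hF⟩)).mono fun arr h => h.2 p p'

theorem sigma_incons {X : Type*} [Tup M X] (i0 : κ) (B : Ultrafilter (κ → V))
    (σ : Ultrafilter (ℕ → κ → V))
    (h1 : ∀ C : (κ → V) → Prop, Df L M C → (∀ᶠ d in (B : Filter (κ → V)), C d) →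
        ∀ j, ∀ᶠ arr in (σ : Filter (ℕ → κ → V)), C (arr j))
    (h2 : ∀ (n : ℕ) (F : (Fin n → V) → Prop), Df L M F → ∀ p p',
        ∀ᶠ arr in (σ : Filter (ℕ → κ → V)),
          F (pth (fun j : Fin n => arr j) p) ↔ F (pth (fun j : Fin n => arr j) p'))
    (Φ : V → X → Prop) (hΦ : Df L M (fun q : V × X => Φ q.1 q.2)) (t : ℕ)
    (ht : NoShatter Φ t)
    (hinc : ∀ᶠ d in (B : Filter (κ → V)), ¬ ∃ x, ∀ i, Φ (d i) x)
    (e : Fin t → ℕ) (he : StrictMono e) :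
    ∀ᶠ arr in (σ : Filter (ℕ → κ → V)), ¬ ∃ x, ∀ j, Φ (arr (e j) i0) x := by
  classical
  have hC : Df L M (fun d : κ → V => ¬ ∃ x, ∀ i, Φ (d i) x) := by
    refine (Df.ex (Df.fall fun i => ?_)).not
    exact hΦ.comp ((Sf.id.fst.app i).prod Sf.id.snd)
  obtain ⟨n, hn⟩ : ∃ n, ∀ j, e j < n :=
    ⟨Finset.univ.sup e + 1, fun j => Nat.lt_succ_of_le (Finset.le_sup (Finset.mem_univ j))⟩
  let F : (Fin t → Bool) → (Fin n → V) → Prop := fun bs c =>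
    ∃ x, ∀ j, Φ (c ⟨e j, hn j⟩) x ↔ bs j = true
  have hF : ∀ bs, Df L M (F bs) := by
    intro bs
    refine Df.ex (Df.fall fun j => Df.iff ?_ (Df.const _))
    exact hΦ.comp ((Sf.id.fst.app _).prod Sf.id.snd)
  have ev1 : ∀ᶠ arr in (σ : Filter (ℕ → κ → V)), ∀ (bs : Fin t → Bool) (p p' : Fin n → κ),
      F bs (pth (fun j : Fin n => arr j) p) ↔ F bs (pth (fun j : Fin n => arr j) p') :=
    Filter.eventually_all.2 fun bs => Filter.eventually_all.2 fun p =>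
      Filter.eventually_all.2 fun p' => h2 n _ (hF bs) p p'
  have ev2 : ∀ᶠ arr in (σ : Filter (ℕ → κ → V)), ∀ q : Fin n, ¬ ∃ x, ∀ i, Φ (arr q i) x :=
    Filter.eventually_all.2 fun q => h1 _ hC hinc q
  filter_upwards [ev1, ev2] with arr ev1 ev2
  rintro ⟨x, hx⟩
  have ev2 : ∀ q : Fin n, ∃ i, ¬ Φ (arr q i) x := by
    intro q
    by_contra h
    push Not at h
    exact ev2 q ⟨x, h⟩
  choose f hf using ev2
  obtain ⟨bs, hbs, hno⟩ := ht (List.ofFn fun j => arr (e j) i0) (by simp)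
  let bf : Fin t → Bool := fun j => bs[(j : ℕ)]'(by rw [hbs]; exact j.2)
  let p : Fin n → κ := fun q => if ∃ j, e j = q ∧ bf j = false then f q else i0
  have h3 : F bf (pth (fun j : Fin n => arr j) p) := by
    refine ⟨x, fun j => ?_⟩
    cases hb : bf j with
    | true =>
      have : ¬ ∃ j', e j' = e j ∧ bf j' = false := by
        rintro ⟨j', h4, h5⟩
        have := he.injective h4
        subst this
        simp [hb] at h5
      simp only [pth, p, this, if_false]
      simpa using hx j
    | false =>
      have : ∃ j', e j' = e j ∧ bf j' = false := ⟨j, rfl, hb⟩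
      simp only [pth, p, this, if_true]
      simpa using hf ⟨e j, hn j⟩
  obtain ⟨x', hx'⟩ := (ev1 bf p (fun _ => i0)).1 h3
  apply hno x'
  rw [List.forall₂_iff_get]
  refine ⟨by simp [hbs], fun i hi hi' => ?_⟩
  have h6 : i < t := by simpa using hi
  simpa [pth, bf] using hx' ⟨i, h6⟩

theorem exists_U [Nonempty M] (hNIP : IsNIP L M) {X : Type*} [Tup M X] (i0 : κ)
    (B : Ultrafilter (κ → V))
    (hB : ∀ A : V → Prop, Df L M A → ∀ i j, ∀ᶠ d in (B : Filter (κ → V)), A (d i) ↔ A (d j))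
    (Φ : V → X → Prop) (hΦ : Df L M (fun q : V × X => Φ q.1 q.2))
    (hinc : ∀ᶠ d in (B : Filter (κ → V)), ¬ ∃ x, ∀ i, Φ (d i) x) :
    ∃ (t : ℕ) (U : Ultrafilter (ℕ → V)),
      (∀ A : V → Prop, Df L M A → (∀ᶠ d in (B : Filter (κ → V)), A (d i0)) →
        ∀ᶠ sq in (U : Filter (ℕ → V)), A (sq 0)) ∧
      (∀ (m : ℕ) (F : (Fin m → V) → Prop), Df L M F → ∀ i j : Fin m → ℕ, StrictMono i →
        StrictMono j →
        ∀ᶠ sq in (U : Filter (ℕ → V)), F (fun a => sq (i a)) ↔ F (fun a => sq (j a))) ∧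
      ∀ᶠ sq in (U : Filter (ℕ → V)), ¬ ∃ x, ∀ j : Fin t, Φ (sq j) x := by
  obtain ⟨σ, h1, h2⟩ := exists_sigma i0 B (claim_all hNIP i0 B hB)
  obtain ⟨ρ, r1, r2⟩ := exists_rho
  obtain ⟨t, ht⟩ := nip_internal hNIP Φ hΦ
  refine ⟨t, ρ.bind (fun k => σ.map (fun arr j => arr (k j) i0)), ?_, ?_, ?_⟩
  · intro A hA hAB
    rw [ev_bind]
    refine Filter.Eventually.of_forall fun k => ?_
    rw [ev_map]
    exact h1 (fun d => A (d i0)) (hA.comp (Sf.id.app i0)) hAB (k 0)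
  · intro m F hF i j hi hj
    rw [ev_bind]
    filter_upwards [r2 m (fun f => ∀ᶠ arr in (σ : Filter (ℕ → κ → V)),
      F (fun a => arr (f a) i0)) i j hi hj] with k hk
    rw [ev_map]
    by_cases h : ∀ᶠ arr in (σ : Filter (ℕ → κ → V)), F (fun a => arr (k (i a)) i0)
    · filter_upwards [h, hk.1 h] with arr h3 h4
      exact ⟨fun _ => h4, fun _ => h3⟩
    · have h' := fun h4 => h (hk.2 h4)
      rw [← Ultrafilter.eventually_not] at h
      have h' := Ultrafilter.eventually_not.2 h'
      filter_upwards [h, h'] with arr h3 h4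
      exact ⟨fun h => absurd h h3, fun h => absurd h h4⟩
  · rw [ev_bind]
    have : ∀ᶠ k in (ρ : Filter (ℕ → ℕ)), ∀ a b : Fin t, a < b → k a < k b :=
      Filter.eventually_all.2 fun a => Filter.eventually_all.2 fun b => by
        by_cases hab : a < b
        · exact (r1 a b hab).mono fun k hk _ => hk
        · exact Filter.Eventually.of_forall fun k h => absurd h hab
    filter_upwards [this] with k hk
    rw [ev_map]
    exact sigma_incons i0 B σ h1 h2 Φ hΦ t ht hinc (fun j => k j) (fun a b hab => hk a b hab)

end sigmaSection
section finalSection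

variable {L} {N : Type w} [L.Structure N]

theorem realize_congr' {K : Type*} [L.Structure K] {α : Type*} (ψ : L.Formula α) {a b : α → K}
    (h : a = b) : ψ.Realize a ↔ ψ.Realize b := by
  rw [h]

theorem exists_B (M : L.ElementarySubstructure N) {κ γ : Type} [Finite κ] [Finite γ]
    (bb : κ → γ → N) : ∃ B : Ultrafilter (κ → γ → M), ∀ ψ : L.Formula (M ⊕ (κ × γ)),
      ψ.Realize (Sum.elim (fun m : M => (m : N)) (fun q => bb q.1 q.2)) →
      ∀ᶠ d in (B : Filter (κ → γ → M)), ψ.Realize (Sum.elim id (fun q => d q.1 q.2)) := by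
  obtain ⟨B, hB⟩ := fip (Z := κ → γ → M) (T := {ψ : L.Formula (M ⊕ (κ × γ)) //
      ψ.Realize (Sum.elim (fun m : M => (m : N)) (fun q => bb q.1 q.2))})
    (fun ψ d => ψ.1.Realize (Sum.elim id (fun q => d q.1 q.2))) (by
      intro s
      let χ : L.Formula (M ⊕ (κ × γ)) := Formula.iInf (fun t : s => t.1.1)
      have h1 : (χ.iExs (κ × γ)).Realize (M.subtype ∘ id) := by
        rw [Formula.realize_iExs]
        refine ⟨fun q => bb q.1 q.2, ?_⟩
        rw [Formula.realize_iInf]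
        intro t
        exact t.1.2
      rw [M.subtype.map_formula, Formula.realize_iExs] at h1
      obtain ⟨d, hd⟩ := h1
      rw [Formula.realize_iInf] at hd
      exact ⟨fun i g => d (i, g), fun t ht => hd ⟨t, ht⟩⟩)
  exact ⟨B, fun ψ hψ => hB ⟨ψ, hψ⟩⟩

theorem nonempty_case [Nonempty N] (M : L.ElementarySubstructure N) (hNIP : IsNIP L N)
    (nx ny np : ℕ) (φ : L.Formula (Fin nx ⊕ (Fin ny ⊕ Fin np))) (mp : Fin np → M)
    (b : Fin ny → N)
    (hndiv : ¬ Divides L (M : Set N) φ (Sum.elim b fun i => ((mp i : N))))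
    (k : ℕ) (bs : Fin k → Fin ny → N)
    (hbs : ∀ i, SameTypeOver L (M : Set N) (bs i) b) :
      ∃ a : Fin nx → N, ∀ i,
        φ.Realize (Sum.elim a (Sum.elim (bs i) fun l => ((mp l : N)))) := by
  by_contra hcon
  apply hndiv
  have hME : M ≅[L] N := M.subtype.elementarilyEquivalent
  have : Nonempty M := hME.nonempty_iff.2 inferInstance
  have hNIPM : IsNIP L M := by
    unfold IsNIP
    rw [hME.completeTheory_eq]
    exact hNIP
  let γ := Fin ny ⊕ Fin np
  let κ := Fin (k + 1)
  let bf : κ → Fin ny → N := Fin.cons b bs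
  have hbf : ∀ i, SameTypeOver L (M : Set N) (bf i) b := by
    intro i
    refine Fin.cases ?_ (fun i => ?_) i
    · intro p ψ m _
      rfl
    · exact hbs i
  let bb : κ → γ → N := fun i => Sum.elim (bf i) (fun l => (mp l : N))
  obtain ⟨B, hBψ⟩ := exists_B M bb
  let Φ : (γ → M) → (Fin nx → M) → Prop := fun y x => φ.Realize (Sum.elim x y)
  have hΦ : Df L M (fun q : (γ → M) × (Fin nx → M) => Φ q.1 q.2) := by
    refine ⟨φ.relabel (Sum.elim (fun a => Sum.inr (Sum.inr (a, ())))
      (fun g => Sum.inr (Sum.inl (g, ())))), fun q => ?_⟩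
    rw [Formula.realize_relabel]
    apply realize_congr'
    funext j
    rcases j with j | j <;> rfl
  have hB : ∀ A : (γ → M) → Prop, Df L M A → ∀ i j,
      ∀ᶠ d in (B : Filter (κ → γ → M)), A (d i) ↔ A (d j) := by
    rintro A ⟨ψ, hψ⟩ i j
    let ψ1 : κ → L.Formula (M ⊕ (κ × γ)) := fun i =>
      ψ.relabel (Sum.elim Sum.inl (fun q : γ × Unit => Sum.inr (i, q.1)))
    have h1 : ∀ i, (ψ1 i).Realize (Sum.elim (fun m : M => (m : N)) (fun q => bb q.1 q.2)) ↔
        ψ.Realize (Sum.elim (fun m : M => (m : N)) (fun q : γ × Unit => bb i q.1)) := by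
      intro i
      rw [Formula.realize_relabel]
      apply realize_congr'
      funext j
      rcases j with j | j <;> rfl
    let ψ2 : L.Formula (M ⊕ Fin ny) := ψ.relabel (Sum.elim Sum.inl (fun q : γ × Unit =>
      Sum.elim (fun y => Sum.inr y) (fun l => Sum.inl (mp l)) q.1))
    have h2 : ∀ i, ψ.Realize (Sum.elim (fun m : M => (m : N)) (fun q : γ × Unit => bb i q.1)) ↔
        ψ2.Realize (Sum.elim (fun m : M => (m : N)) (bf i)) := by
      intro i
      rw [Formula.realize_relabel]
      apply realize_congr'
      funext j
      rcases j with j | ⟨j | j, _⟩ <;> rfl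
    obtain ⟨p, ψ3, m, hm⟩ := fin_params.{u, v, w, w, 0} ψ2
    have h3 : ∀ i, ψ2.Realize (Sum.elim (fun m : M => (m : N)) (bf i)) ↔
        ψ2.Realize (Sum.elim (fun m : M => (m : N)) b) := by
      intro i
      rw [← hm N, ← hm N]
      exact hbf i p ψ3 _ (fun r => (m r).2)
    have h4 := hBψ ((ψ1 i).iff (ψ1 j)) (by
      rw [Formula.realize_iff, h1, h1, h2, h2, h3 i, h3 j])
    filter_upwards [h4] with d hd
    rw [Formula.realize_iff, Formula.realize_relabel, Formula.realize_relabel] at hd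
    rw [hψ, hψ]
    convert hd using 1
    · apply realize_congr'
      funext j
      rcases j with j | j <;> rfl
    · apply realize_congr'
      funext j
      rcases j with j | j <;> rfl
  have hinc : ∀ᶠ d in (B : Filter (κ → γ → M)), ¬ ∃ x, ∀ i, Φ (d i) x := by
    let χ : L.Formula (M ⊕ (κ × γ)) := (Formula.iExs (Fin nx) (Formula.iInf fun i : κ =>
      φ.relabel (Sum.elim Sum.inr (fun g => Sum.inl (Sum.inr (i, g)))))).not
    have h1 := hBψ χ (by
      rw [Formula.realize_not, Formula.realize_iExs]
      rintro ⟨a, ha⟩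
      rw [Formula.realize_iInf] at ha
      apply hcon
      refine ⟨a, fun i => ?_⟩
      have h2 := ha i.succ
      rw [Formula.realize_relabel] at h2
      refine (realize_congr' φ ?_).1 h2
      funext j
      rcases j with j | j | j <;> rfl)
    filter_upwards [h1] with d hd
    rintro ⟨x, hx⟩
    rw [Formula.realize_not, Formula.realize_iExs] at hd
    apply hd
    refine ⟨x, ?_⟩
    rw [Formula.realize_iInf]
    intro i
    rw [Formula.realize_relabel]
    refine (realize_congr' φ ?_).1 (hx i)
    funext j
    rcases j with j | j <;> rfl
  obtain ⟨t, U, U1, U2, U3⟩ := exists_U hNIPM (0 : κ) B hB Φ hΦ hinc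
  obtain ⟨K, iK, q, emb, hemb, los⟩ := ultra_exists.{u, v, w, 0} (L := L) U N
  let c : ℕ → γ → K := fun j g => q (fun sq => (sq j g : N))
  -- transfer of formulas with parameters in `M`
  have tr : ∀ (α : Type) (θ : L.Formula α) (f : α → (ℕ → γ → M) → M),
      θ.Realize (fun x => q (fun sq => (f x sq : N))) ↔
        ∀ᶠ sq in (U : Filter (ℕ → γ → M)), θ.Realize (fun x => f x sq) := by
    intro α θ f
    rw [los α θ (fun x sq => (f x sq : N))]
    refine Filter.eventually_congr (Filter.Eventually.of_forall fun sq => ?_)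
    exact M.subtype.map_formula θ (fun x => f x sq)
  have prm : ∀ (p : ℕ) (m : Fin p → K), (∀ i, m i ∈ (⇑emb '' (M : Set N))) →
      ∃ m' : Fin p → M, ∀ i, m i = q (fun _ => (m' i : N)) := by
    intro p m hm
    choose n hn hn' using hm
    exact ⟨fun i => ⟨n i, hn i⟩, fun i => by rw [← hn' i, hemb]⟩
  have dfF : ∀ (m p : ℕ) (θ : L.Formula ((Fin m × γ) ⊕ Fin p)) (m' : Fin p → M),
      Df L M (fun y : Fin m → γ → M => θ.Realize (Sum.elim (fun r => y r.1 r.2) m')) := by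
    intro m p θ m'
    refine ⟨θ.relabel (Sum.elim (fun r => Sum.inr (r.1, (r.2, ()))) (fun i => Sum.inl (m' i))),
      fun y => ?_⟩
    rw [Formula.realize_relabel]
    apply realize_congr'
    funext j
    rcases j with j | j <;> rfl
  have dfA : ∀ (p : ℕ) (θ : L.Formula (γ ⊕ Fin p)) (m' : Fin p → M),
      Df L M (fun y : γ → M => θ.Realize (Sum.elim y m')) := by
    intro p θ m'
    refine ⟨θ.relabel (Sum.elim (fun r => Sum.inr (r, ())) (fun i => Sum.inl (m' i))),
      fun y => ?_⟩
    rw [Formula.realize_relabel]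
    apply realize_congr'
    funext j
    rcases j with j | j <;> rfl
  refine ⟨@ElemExt.mk L N _ K iK emb, c, ?_, ?_, ?_⟩
  · intro m i j hi hj p θ pr hpr
    obtain ⟨m', hm'⟩ := prm p pr hpr
    have key : ∀ i : Fin m → ℕ,
        θ.Realize (Sum.elim (fun r : Fin m × γ => c (i r.1) r.2) pr) ↔
        ∀ᶠ sq in (U : Filter (ℕ → γ → M)),
          θ.Realize (Sum.elim (fun r : Fin m × γ => sq (i r.1) r.2) m') := by
      intro i
      have h := tr _ θ (Sum.elim (fun r sq => sq (i r.1) r.2) (fun r _ => m' r))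
      refine Iff.trans (realize_congr' θ ?_) (h.trans (Filter.eventually_congr
        (Filter.Eventually.of_forall fun sq => realize_congr' θ ?_)))
      · funext x
        rcases x with x | x
        · rfl
        · exact hm' x
      · funext x
        rcases x with x | x <;> rfl
    refine (key i).trans (Iff.trans ?_ (key j).symm)
    exact Filter.eventually_congr (U2 m _ (dfF m p θ m') i j hi hj)
  · intro p θ pr hpr
    obtain ⟨m', hm'⟩ := prm p pr hpr
    have key : θ.Realize (Sum.elim (c 0) pr) ↔
        ∀ᶠ sq in (U : Filter (ℕ → γ → M)), θ.Realize (Sum.elim (sq 0) m') := by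
      have h := tr _ θ (Sum.elim (fun r sq => sq 0 r) (fun r _ => m' r))
      refine Iff.trans (realize_congr' θ ?_) (h.trans (Filter.eventually_congr
        (Filter.Eventually.of_forall fun sq => realize_congr' θ ?_)))
      · funext x
        rcases x with x | x
        · rfl
        · exact hm' x
      · funext x
        rcases x with x | x <;> rfl
    have key2 : θ.Realize (Sum.elim (⇑emb ∘ (bb 0)) pr) ↔
        θ.Realize (Sum.elim (bb 0) (fun r => (m' r : N))) := by
      have h := emb.map_formula θ (Sum.elim (bb 0) (fun r => (m' r : N)))
      refine Iff.trans (realize_congr' θ ?_) h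
      funext x
      rcases x with x | x
      · rfl
      · change pr x = emb (m' x)
        rw [hm' x, hemb]
    have key3 : ∀ θ : L.Formula (γ ⊕ Fin p),
        θ.Realize (Sum.elim (bb 0) (fun r => (m' r : N))) →
        ∀ᶠ sq in (U : Filter (ℕ → γ → M)), θ.Realize (Sum.elim (sq 0) m') := by
      intro θ hθ
      refine U1 _ (dfA p θ m') ?_
      have h1 := hBψ (θ.relabel (Sum.elim (fun g => Sum.inr (0, g)) (fun r => Sum.inl (m' r)))) (by
        rw [Formula.realize_relabel]
        refine (realize_congr' θ ?_).1 hθ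
        funext x
        rcases x with x | x <;> rfl)
      filter_upwards [h1] with d hd
      rw [Formula.realize_relabel] at hd
      refine (realize_congr' θ ?_).1 hd
      funext x
      rcases x with x | x <;> rfl
    refine key.trans (Iff.trans ?_ key2.symm)
    constructor
    · intro h
      by_contra h2
      have h3 := key3 θ.not (by rwa [Formula.realize_not])
      obtain ⟨sq, h4, h5⟩ := (h.and h3).exists
      rw [Formula.realize_not] at h5
      exact h5 h4
    · exact key3 θ
  · intro hcons
    obtain ⟨a, ha⟩ := hcons (Finset.range t)
    let χ : L.Formula (Fin t × γ) := Formula.iExs (Fin nx) (Formula.iInf fun i : Fin t =>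
      φ.relabel (Sum.elim Sum.inr (fun g => Sum.inl (i, g))))
    have h1 : χ.Realize (fun x : Fin t × γ => q (fun sq => (sq x.1 x.2 : N))) := by
      rw [Formula.realize_iExs]
      refine ⟨a, ?_⟩
      rw [Formula.realize_iInf]
      intro i
      rw [Formula.realize_relabel]
      refine (realize_congr' φ ?_).1 (ha i (Finset.mem_range.2 i.2))
      funext x
      rcases x with x | x <;> rfl
    have h2 := (tr _ χ (fun x sq => sq x.1 x.2)).1 h1
    obtain ⟨sq, h3, h4⟩ := (h2.and U3).exists
    rw [Formula.realize_iExs] at h3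
    obtain ⟨x, hx⟩ := h3
    rw [Formula.realize_iInf] at hx
    apply h4
    refine ⟨x, fun j => ?_⟩
    have h5 := hx j
    rw [Formula.realize_relabel] at h5
    refine (realize_congr' φ ?_).1 h5
    funext x
    rcases x with x | x <;> rfl

theorem empty_case [IsEmpty N] (M : L.ElementarySubstructure N)
    (nx ny np : ℕ) (φ : L.Formula (Fin nx ⊕ (Fin ny ⊕ Fin np))) (mp : Fin np → M)
    (b : Fin ny → N)
    (hndiv : ¬ Divides L (M : Set N) φ (Sum.elim b fun i => ((mp i : N))))
    (k : ℕ) (bs : Fin k → Fin ny → N) :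
      ∃ a : Fin nx → N, ∀ i,
        φ.Realize (Sum.elim a (Sum.elim (bs i) fun l => ((mp l : N)))) := by
  by_contra hcon
  apply hndiv
  let iK : L.Structure (ULift.{max u v} N) :=
    Equiv.inducedStructure (Equiv.ulift.{max u v} (α := N)).symm
  let e : N ≃[L] ULift.{max u v} N :=
    Equiv.inducedStructureEquiv (Equiv.ulift.{max u v} (α := N)).symm
  refine ⟨@ElemExt.mk L N _ (ULift.{max u v} N) iK e.toElementaryEmbedding,
    fun _ => e ∘ (Sum.elim b fun i => ((mp i : N))), ?_, ?_, ?_⟩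
  · intro m i j _ _ p θ pr _
    rfl
  · intro p θ pr _
    rfl
  · intro hcons
    obtain ⟨a, ha⟩ := hcons {0}
    apply hcon
    refine ⟨fun i => (a i).down, fun i => ?_⟩
    have h := ha 0 (by simp)
    have hb : bs i = b := Subsingleton.elim _ _
    rw [hb]
    have h2 := StrongHomClass.realize_formula e φ
      (v := Sum.elim (fun i => (a i).down) (Sum.elim b fun l => ((mp l : N))))
    refine h2.1 ((realize_congr' φ ?_).1 h)
    funext x
    rcases x with x | x <;> rfl

end finalSection

/-- Proposition 2.1 of the paper. Let `M ⪯ N` be models of a complete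
NIP theory. Let `φ(x, y)` be an `L`-formula with parameters `mp` from `M` and let `b` be a
tuple from `N`. If `φ(x, b)` does not divide over `M`, then the family
`{φ(x, b') : b'` a tuple from `N` realizing `q = tp(b/M)}` is consistent
(finitely satisfiable). -/
theorem statement1 {L : FirstOrder.Language.{u, v}} {N : Type w} [L.Structure N]
    (M : L.ElementarySubstructure N) (hNIP : IsNIP L N)
    (nx ny np : ℕ) (φ : L.Formula (Fin nx ⊕ (Fin ny ⊕ Fin np))) (mp : Fin np → M)
    (b : Fin ny → N)
    (hndiv : ¬ Divides L (M : Set N) φ (Sum.elim b fun i => ((mp i : N)))) :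
    ∀ (k : ℕ) (bs : Fin k → Fin ny → N),
      (∀ i, SameTypeOver L (M : Set N) (bs i) b) →
      ∃ a : Fin nx → N, ∀ i,
        φ.Realize (Sum.elim a (Sum.elim (bs i) fun l => ((mp l : N)))) := by
  intro k bs hbs
  rcases isEmpty_or_nonempty N with hN | hN
  · exact empty_case M nx ny np φ mp b hndiv k bs
  · exact nonempty_case M hNIP nx ny np φ mp b hndiv k bs hbs

end DistalPaper
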